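/- The three-qubit W state W = (|001⟩ + |010⟩ + |100⟩)/√3 is not locally maximally entanglable: there do not exist 2×2 unitary matrices U₁, U₂, U₃ such that the eight vectors U₁^{i₁} ⊗ U₂^{i₂} ⊗ U₃^{i₃} W, for (i₁,i₂,i₃) ∈ {0,1}³, form an orthonormal basis of ℂ⁸. -/

import Mathlib

open Complex

noncomputable section

/-- Identify a bit with an index into `Fin 2`. -/
def bIdx (b : Bool) : Fin 2 := if b then 1 else 0

/-- The action of the tensor product `U 0 ⊗ U 1 ⊗ ⋯ ⊗ U (n-1)` of 2×2 matrices on an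
`n`-qubit vector `ψ : (Fin n → Bool) → ℂ`. -/
def tensorAction {n : ℕ} (U : Fin n → Matrix (Fin 2) (Fin 2) ℂ)
    (ψ : (Fin n → Bool) → ℂ) : (Fin n → Bool) → ℂ :=
  fun i => ∑ j : Fin n → Bool, (∏ k, U k (bIdx (i k)) (bIdx (j k))) * ψ j

/-- The standard Hermitian inner product on `ℂ^ι`. -/
def hinner {ι : Type*} [Fintype ι] (ψ φ : ι → ℂ) : ℂ :=
  ∑ i, (starRingEnd ℂ) (ψ i) * φ i

/-- `U^b` for a bit `b`: the identity if `b = 0`, and `U` if `b = 1`. -/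
def bpow (U : Matrix (Fin 2) (Fin 2) ℂ) (b : Bool) : Matrix (Fin 2) (Fin 2) ℂ :=
  if b then U else 1

/-- The three-qubit `W` state `(|001⟩ + |010⟩ + |100⟩)/√3`: amplitude `1/√3` on bit strings
of Hamming weight one, and `0` elsewhere. -/
def Wstate : (Fin 3 → Bool) → ℂ :=
  fun i => if (∑ k, (if i k then 1 else 0 : ℕ)) = 1 then (Real.sqrt 3 : ℂ)⁻¹ else 0

theorem sum_three_bits {M : Type*} [AddCommMonoid M] (f : (Fin 3 → Bool) → M) :
    ∑ i, f i = ∑ a, ∑ b, ∑ c, f ![a, b, c] := by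
  rw [← (Fin.consEquiv fun _ => Bool).sum_comp, Fintype.sum_prod_type]
  refine Finset.sum_congr rfl fun a _ => ?_
  rw [← (Fin.consEquiv fun _ => Bool).sum_comp, Fintype.sum_prod_type]
  refine Finset.sum_congr rfl fun b _ => ?_
  rw [← (Fin.consEquiv fun _ => Bool).sum_comp, Fintype.sum_prod_type]
  refine Finset.sum_congr rfl fun c _ => ?_
  rw [Fintype.sum_unique]
  congr 1

/-- The matrix element `⟨W| V 0 ⊗ V 1 ⊗ V 2 |W⟩`, written out. -/
theorem hinner_Wstate_tensorAction (V : Fin 3 → Matrix (Fin 2) (Fin 2) ℂ) :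
    3 * hinner Wstate (tensorAction V Wstate) =
      V 0 1 1 * V 1 0 0 * V 2 0 0 + V 0 0 0 * V 1 1 1 * V 2 0 0 + V 0 0 0 * V 1 0 0 * V 2 1 1
      + V 0 1 0 * V 1 0 1 * V 2 0 0 + V 0 0 1 * V 1 1 0 * V 2 0 0
      + V 0 1 0 * V 1 0 0 * V 2 0 1 + V 0 0 1 * V 1 0 0 * V 2 1 0
      + V 0 0 0 * V 1 1 0 * V 2 0 1 + V 0 0 0 * V 1 0 1 * V 2 1 0 := by
  have h3 : ((Real.sqrt 3 : ℝ) : ℂ)⁻¹ ^ 2 = 1 / 3 := by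
    rw [inv_pow, ← Complex.ofReal_pow, Real.sq_sqrt (by norm_num)]
    norm_num
  simp only [hinner, tensorAction, sum_three_bits, Fintype.sum_bool, Fin.prod_univ_three,
    Fin.sum_univ_three, Wstate, bIdx]
  simp
  simp only [inv_pow] at h3
  linear_combination 3 * (
      V 0 1 1 * V 1 0 0 * V 2 0 0 + V 0 0 0 * V 1 1 1 * V 2 0 0 + V 0 0 0 * V 1 0 0 * V 2 1 1
      + V 0 1 0 * V 1 0 1 * V 2 0 0 + V 0 0 1 * V 1 1 0 * V 2 0 0
      + V 0 1 0 * V 1 0 0 * V 2 0 1 + V 0 0 1 * V 1 0 0 * V 2 1 0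
      + V 0 0 0 * V 1 1 0 * V 2 0 1 + V 0 0 0 * V 1 0 1 * V 2 1 0) * h3

theorem tensorAction_one {n : ℕ} (ψ : (Fin n → Bool) → ℂ) :
    tensorAction (fun _ => 1) ψ = ψ := by
  have hb : Function.Injective bIdx := by
    intro a b
    cases a <;> cases b <;> simp [bIdx]
  funext i
  rw [tensorAction, Finset.sum_eq_single i]
  · simp
  · intro j _ hj
    obtain ⟨k, hk⟩ := Function.ne_iff.mp hj
    rw [Finset.prod_eq_zero (Finset.mem_univ k), zero_mul]
    exact Matrix.one_apply_ne fun h => hk (hb h).symm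
  · simp

/-- A 2×2 unitary whose diagonal satisfies `2 a + d = 0` is antidiagonal. -/
theorem antidiagonal_of_mem_unitaryGroup {U : Matrix (Fin 2) (Fin 2) ℂ}
    (hU : U ∈ Matrix.unitaryGroup (Fin 2) ℂ) (h : 2 * U 0 0 + U 1 1 = 0) :
    U 0 0 = 0 ∧ U 1 1 = 0 ∧ U 0 1 ≠ 0 ∧ U 1 0 ≠ 0 := by
  have row := congrFun (congrFun (Matrix.mem_unitaryGroup_iff.mp hU) 0) 0
  have col := congrFun (congrFun (Matrix.mem_unitaryGroup_iff'.mp hU) 1) 1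
  have col₀ := congrFun (congrFun (Matrix.mem_unitaryGroup_iff'.mp hU) 0) 0
  simp only [Matrix.mul_apply, Fin.sum_univ_two, Matrix.star_apply, Matrix.one_apply_eq,
    RCLike.star_def] at row col col₀
  have hd : U 1 1 = -2 * U 0 0 := by linear_combination h
  have ha : U 0 0 = 0 := by
    rw [hd] at col
    simp only [map_mul, map_neg, map_ofNat] at col
    have : U 0 0 * (starRingEnd ℂ) (U 0 0) = 0 := by
      linear_combination (col - row) / 3
    simpa using this
  rw [ha, mul_zero] at hd
  refine ⟨ha, hd, fun hb => ?_, fun hc => ?_⟩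
  · simp [ha, hb] at row
  · simp [ha, hc] at col₀

/-- the three-qubit `W` state is not locally maximally entanglable: there are
no 2×2 unitaries `U₁, U₂, U₃` such that the eight vectors `U₁^{i₁} ⊗ U₂^{i₂} ⊗ U₃^{i₃} W`
form an orthonormal basis of `ℂ⁸`. -/
theorem W_state_not_lme :
    ¬ ∃ U : Fin 3 → Matrix (Fin 2) (Fin 2) ℂ,
        (∀ k, U k ∈ Matrix.unitaryGroup (Fin 2) ℂ) ∧
        (∀ s t : Fin 3 → Bool,
          hinner (tensorAction (fun k => bpow (U k) (s k)) Wstate)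
                 (tensorAction (fun k => bpow (U k) (t k)) Wstate) =
            if s = t then 1 else 0) ∧
        Submodule.span ℂ (Set.range fun s : Fin 3 → Bool =>
          tensorAction (fun k => bpow (U k) (s k)) Wstate) = ⊤ := by
  rintro ⟨U, hU, h, -⟩
  have key (t : Fin 3 → Bool) (ht : t ≠ fun _ => false) :
      3 * hinner Wstate (tensorAction (fun k => bpow (U k) (t k)) Wstate) = 0 := by
    have h₀ := h (fun _ => false) t
    rw [if_neg ht.symm] at h₀
    simp only [bpow, Bool.false_eq_true, if_false, tensorAction_one] at h₀
    exact mul_eq_zero_of_right _ h₀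
  simp only [hinner_Wstate_tensorAction] at key
  have k₀ := key ![true, false, false] (by decide)
  have k₁ := key ![false, true, false] (by decide)
  have k₂ := key ![false, false, true] (by decide)
  have k₀₁ := key ![true, true, false] (by decide)
  have k₀₂ := key ![true, false, true] (by decide)
  have k₁₂ := key ![false, true, true] (by decide)
  simp [bpow] at k₀ k₁ k₂ k₀₁ k₀₂ k₁₂
  obtain ⟨a₀, d₀, b₀, c₀⟩ :=
    antidiagonal_of_mem_unitaryGroup (hU 0) (by linear_combination k₀)
  obtain ⟨a₁, d₁, b₁, c₁⟩ :=
    antidiagonal_of_mem_unitaryGroup (hU 1) (by linear_combination k₁)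
  obtain ⟨a₂, d₂, b₂, c₂⟩ :=
    antidiagonal_of_mem_unitaryGroup (hU 2) (by linear_combination k₂)
  simp only [a₀, a₁, a₂, d₀, d₁, d₂, mul_zero, zero_add, add_zero] at k₀₁ k₀₂ k₁₂
  have : 2 * (U 0 0 1 * U 1 1 0 * U 2 1 0) = 0 := by
    linear_combination U 2 1 0 * k₀₁ + U 1 1 0 * k₀₂ - U 0 1 0 * k₁₂
  simp_all
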